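/- arXiv:2507.06962 — 2 statements merged into one kernel-verified Lean document; each statement's English description precedes it below -/
import Mathlib

section
/- Fix 1 ≤ p < ∞. Let V be a real Banach space, v ∈ V, and δ : V × V → V an ℝ-linear map such that δ(v, v) = v and ‖δ(x, y)‖ ≤ ((‖x‖^p + ‖y‖^p)/2)^{1/p} for all x, y ∈ V. Then there exists a unique continuous linear map θ : L^p([0,1]; ℝ) → V such that θ(1_{[0,1]}) = v and θ(γ(f, g)) = δ(θ(f), θ(g)) for all f, g ∈ L^p([0,1]; ℝ), where 1_{[0,1]} denotes the constant function 1. -/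
open MeasureTheory

/-- Lebesgue measure restricted to `[0,1]`. -/
noncomputable def unitMeasure : Measure ℝ := volume.restrict (Set.Icc (0:ℝ) 1)

/-- The juxtaposition `γ(f,g)(x) = f(2x)` for `x < 1/2`, `g(2x − 1)` for `x ≥ 1/2`. -/
noncomputable def gammaFun {E : Type*} (f g : ℝ → E) (x : ℝ) : E :=
  if x < 1/2 then f (2 * x) else g (2 * x - 1)

open Filter Topology

section SelfSimilar

variable {X V : Type*} [NormedAddCommGroup X] [NormedSpace ℝ X]
  [NormedAddCommGroup V] [NormedSpace ℝ V]

/-- The `n`-th approximation to the map `θ` determined by `v` and `δ`: split the input `n` times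
using `L` and `R`, replace each piece `x` by `φ x • v`, and reassemble the results using `δ`. -/
noncomputable def splitApprox (L R : X →ₗ[ℝ] X) (φ : X →ₗ[ℝ] ℝ) (v : V) (δ : (V × V) →ₗ[ℝ] V) :
    ℕ → X →ₗ[ℝ] V
  | 0 => φ.smulRight v
  | n + 1 => δ ∘ₗ ((splitApprox L R φ v δ n ∘ₗ L).prod (splitApprox L R φ v δ n ∘ₗ R))

variable {L R : X →ₗ[ℝ] X} {φ : X →ₗ[ℝ] ℝ} {v : V} {δ : (V × V) →ₗ[ℝ] V} {p : ℝ}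

lemma splitApprox_zero (x : X) : splitApprox L R φ v δ 0 x = φ x • v := rfl

lemma splitApprox_succ (n : ℕ) (x : X) : splitApprox L R φ v δ (n + 1) x =
    δ (splitApprox L R φ v δ n (L x), splitApprox L R φ v δ n (R x)) := rfl

lemma norm_splitApprox_le (hp : 0 < p)
    (hLR : ∀ x, ‖x‖ ^ p = (‖L x‖ ^ p + ‖R x‖ ^ p) / 2) (hφ : ∀ x, |φ x| ≤ ‖x‖)
    (hδ : ∀ x y : V, ‖δ (x, y)‖ ≤ ((‖x‖ ^ p + ‖y‖ ^ p) / 2) ^ (1 / p)) (n : ℕ) (x : X) :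
    ‖splitApprox L R φ v δ n x‖ ≤ ‖x‖ * ‖v‖ := by
  induction n generalizing x with
  | zero =>
    rw [splitApprox_zero, norm_smul, Real.norm_eq_abs]
    gcongr
    exact hφ x
  | succ n ih =>
    rw [splitApprox_succ]
    refine (hδ _ _).trans ?_
    have hx : ‖x‖ * ‖v‖ = (((‖L x‖ * ‖v‖) ^ p + (‖R x‖ * ‖v‖) ^ p) / 2) ^ (1 / p) := by
      rw [Real.mul_rpow (norm_nonneg _) (norm_nonneg _),
        Real.mul_rpow (norm_nonneg _) (norm_nonneg _), ← add_mul, mul_div_right_comm, ← hLR,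
        ← Real.mul_rpow (norm_nonneg _) (norm_nonneg _), one_div,
        Real.rpow_rpow_inv (by positivity) hp.ne']
    rw [hx]
    gcongr
    · exact ih _
    · exact ih _

lemma splitApprox_smul (one : X) (hL : L one = one) (hR : R one = one) (hφ : φ one = 1)
    (hδ : δ (v, v) = v) (n : ℕ) (c : ℝ) : splitApprox L R φ v δ n (c • one) = c • v := by
  rw [map_smul]
  congr 1
  induction n with
  | zero => rw [splitApprox_zero, hφ, one_smul]
  | succ n ih => rw [splitApprox_succ, hL, hR, ih, hδ]

/-- A linear map intertwining `γ` and `δ` intertwines the corresponding approximations. -/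
lemma map_splitApprox {γ : (X × X) →ₗ[ℝ] X} {one : X} (θ : X →ₗ[ℝ] V) (h1 : θ one = v)
    (hγ : ∀ z, θ (γ z) = δ (θ z.1, θ z.2)) (n : ℕ) (x : X) :
    θ (splitApprox L R φ one γ n x) = splitApprox L R φ v δ n x := by
  induction n generalizing x with
  | zero => rw [splitApprox_zero, splitApprox_zero, map_smul, h1]
  | succ n ih => rw [splitApprox_succ, splitApprox_succ, hγ, ih, ih]

lemma splitApprox_splitApprox {γ : (X × X) →ₗ[ℝ] X} {one : X}
    (hL : L one = one) (hR : R one = one) (hφ : φ one = 1) (hδ : δ (v, v) = v)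
    (hγL : ∀ z, L (γ z) = z.1) (hγR : ∀ z, R (γ z) = z.2) {m n : ℕ} (hmn : m ≤ n) (x : X) :
    splitApprox L R φ v δ n (splitApprox L R φ one γ m x) = splitApprox L R φ v δ m x := by
  induction m generalizing n x with
  | zero => rw [splitApprox_zero, splitApprox_zero, splitApprox_smul one hL hR hφ hδ]
  | succ m ih =>
    obtain ⟨k, rfl⟩ : ∃ k, n = k + 1 := ⟨n - 1, by lia⟩
    rw [splitApprox_succ m, splitApprox_succ k, hγL, hγR, ih (by lia), ih (by lia),
      splitApprox_succ]

/-- If the approximations in `X` itself converge to the identity, then `X` is initial among Banach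
spaces `V` with a point `v` and a map `δ` fixing `(v, v)` and bounded by the `p`-th power mean. -/
theorem existsUnique_of_tendsto_splitApprox [CompleteSpace V] (hp : 0 < p)
    (hLR : ∀ x, ‖x‖ ^ p = (‖L x‖ ^ p + ‖R x‖ ^ p) / 2) (hφ : ∀ x, |φ x| ≤ ‖x‖)
    {γ : (X × X) →ₗ[ℝ] X} {one : X}
    (hL : L one = one) (hR : R one = one) (hφ1 : φ one = 1)
    (hγL : ∀ z, L (γ z) = z.1) (hγR : ∀ z, R (γ z) = z.2)
    (hlim : ∀ x, Tendsto (fun n => splitApprox L R φ one γ n x) atTop (𝓝 x))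
    (hδ1 : δ (v, v) = v)
    (hδ : ∀ x y : V, ‖δ (x, y)‖ ≤ ((‖x‖ ^ p + ‖y‖ ^ p) / 2) ^ (1 / p)) :
    ∃! θ : X →L[ℝ] V, θ one = v ∧ ∀ z, θ (γ z) = δ (θ z.1, θ z.2) := by
  have hconv (x : X) : ∃ y, Tendsto (fun n => splitApprox L R φ v δ n x) atTop (𝓝 y) := by
    refine cauchySeq_tendsto_of_complete
      (cauchySeq_of_le_tendsto_0' (fun m => ‖x - splitApprox L R φ one γ m x‖ * ‖v‖) ?_ ?_)
    · intro m n hmn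
      rw [dist_comm, dist_eq_norm, ← splitApprox_splitApprox hL hR hφ1 hδ1 hγL hγR hmn x,
        ← map_sub]
      exact norm_splitApprox_le hp hLR hφ hδ n _
    · have := ((tendsto_const_nhds (x := x)).sub (hlim x)).norm.mul_const ‖v‖
      simpa using this
  choose T hT using hconv
  have hδc : Continuous δ := by
    refine (δ.mkContinuous 1 fun z => ?_).continuous
    rw [one_mul]
    calc ‖δ z‖ ≤ ((‖z.1‖ ^ p + ‖z.2‖ ^ p) / 2) ^ (1 / p) := hδ z.1 z.2
      _ ≤ ((‖z‖ ^ p + ‖z‖ ^ p) / 2) ^ (1 / p) := by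
        gcongr
        · exact norm_fst_le z
        · exact norm_snd_le z
      _ = ‖z‖ := by
        rw [add_self_div_two, one_div, Real.rpow_rpow_inv (norm_nonneg _) hp.ne']
  let T' : X →ₗ[ℝ] V := linearMapOfTendsto T (fun n => splitApprox L R φ v δ n)
    (tendsto_pi_nhds.2 hT)
  refine ⟨T'.mkContinuous ‖v‖ fun x => ?_, ⟨?_, fun z => ?_⟩, fun θ hθ => ?_⟩
  · rw [mul_comm]
    exact le_of_tendsto (hT x).norm
      (Eventually.of_forall fun n => norm_splitApprox_le hp hLR hφ hδ n x)
  · refine tendsto_nhds_unique (hT one) ?_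
    have h (n : ℕ) : splitApprox L R φ v δ n one = v := by
      simpa using splitApprox_smul one hL hR hφ1 hδ1 n 1
    simp [h]
  · refine tendsto_nhds_unique ((hT (γ z)).comp (tendsto_add_atTop_nat 1)) ?_
    have h : Tendsto (fun n => δ (splitApprox L R φ v δ n z.1, splitApprox L R φ v δ n z.2)) atTop
        (𝓝 (δ (T z.1, T z.2))) := (hδc.tendsto _).comp ((hT z.1).prodMk_nhds (hT z.2))
    refine h.congr fun n => ?_
    rw [Function.comp_apply, splitApprox_succ, hγL, hγR]
  · ext x
    refine tendsto_nhds_unique ?_ (hT x)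
    have h := (θ.continuous.tendsto x).comp (hlim x)
    refine h.congr fun n => ?_
    exact map_splitApprox (θ : X →ₗ[ℝ] V) hθ.1 hθ.2 n x

end SelfSimilar

open scoped ENNReal

instance : IsProbabilityMeasure unitMeasure := ⟨by simp [unitMeasure]⟩

instance : unitMeasure.Regular := by unfold unitMeasure; infer_instance

lemma ae_unitMeasure_mem : ∀ᵐ x ∂unitMeasure, x ∈ Set.Ico (0 : ℝ) 1 := by
  rw [unitMeasure, ← Measure.restrict_congr_set Ico_ae_eq_Icc]
  exact ae_restrict_mem measurableSet_Ico

lemma map_half_unitMeasure (t : ℝ) :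
    unitMeasure.map (fun x : ℝ => x / 2 + t) =
      (2 : ℝ≥0∞) • volume.restrict (Set.Icc t (t + 1 / 2)) := by
  have h1 : (volume : Measure ℝ).map (fun x : ℝ => x / 2 + t) = (2 : ℝ≥0∞) • volume := by
    have : (fun x : ℝ => x / 2 + t) = (fun x => x + t) ∘ (fun x => x * (1 / 2)) := by
      ext x; simp [div_eq_mul_inv]
    rw [this, ← Measure.map_map (by fun_prop) (by fun_prop),
      Real.map_volume_mul_right (by norm_num), Measure.map_smul, map_add_right_eq_self]
    norm_num
  have h2 : (fun x : ℝ => x / 2 + t) ⁻¹' (Set.Icc t (t + 1 / 2)) = Set.Icc 0 1 := by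
    ext x
    simp only [Set.mem_preimage, Set.mem_Icc]
    constructor <;> rintro ⟨_, _⟩ <;> constructor <;> linarith
  rw [unitMeasure, ← h2, ← Measure.restrict_map (by fun_prop) measurableSet_Icc, h1,
    Measure.restrict_smul]

lemma map_half_add_map_half_unitMeasure :
    unitMeasure.map (fun x : ℝ => x / 2 + 0) + unitMeasure.map (fun x : ℝ => x / 2 + 1 / 2) =
      (2 : ℝ≥0∞) • unitMeasure := by
  rw [map_half_unitMeasure, map_half_unitMeasure, ← smul_add, unitMeasure,
    ← Measure.restrict_congr_set (Ico_ae_eq_Icc (a := (0 : ℝ))),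
    ← Measure.restrict_union _ measurableSet_Icc]
  · norm_num [Set.Ico_union_Icc_eq_Icc]
  · rw [Set.disjoint_left]
    intro x hx hx'
    have := hx.2
    have := hx'.1
    linarith

lemma map_half_le_unitMeasure {t : ℝ} (ht : t = 0 ∨ t = 1 / 2) :
    unitMeasure.map (fun x : ℝ => x / 2 + t) ≤ (2 : ℝ≥0∞) • unitMeasure := by
  rw [← map_half_add_map_half_unitMeasure]
  obtain rfl | rfl := ht
  · exact Measure.le_add_right le_rfl
  · exact Measure.le_add_left le_rfl

lemma quasiMeasurePreserving_half {t : ℝ} (ht : t = 0 ∨ t = 1 / 2) :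
    Measure.QuasiMeasurePreserving (fun x : ℝ => x / 2 + t) unitMeasure unitMeasure :=
  ⟨by fun_prop, (Measure.absolutelyContinuous_of_le (map_half_le_unitMeasure ht)).trans
    Measure.smul_absolutelyContinuous⟩

lemma lintegral_unitMeasure_eq {f : ℝ → ℝ≥0∞} (hf : AEMeasurable f unitMeasure) :
    2 * ∫⁻ x, f x ∂unitMeasure =
      ∫⁻ x, f (x / 2 + 0) ∂unitMeasure + ∫⁻ x, f (x / 2 + 1 / 2) ∂unitMeasure := by
  have h0 := quasiMeasurePreserving_half (.inl rfl)
  have h1 := quasiMeasurePreserving_half (.inr rfl)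
  rw [← smul_eq_mul, ← lintegral_smul_measure, ← map_half_add_map_half_unitMeasure,
    lintegral_add_measure,
    lintegral_map' (hf.mono_ac h0.absolutelyContinuous) h0.measurable.aemeasurable,
    lintegral_map' (hf.mono_ac h1.absolutelyContinuous) h1.measurable.aemeasurable]

section Lp

variable {q : ℝ≥0∞} {t : ℝ}

lemma memLp_comp_half (ht : t = 0 ∨ t = 1 / 2) {f : ℝ → ℝ} (hf : MemLp f q unitMeasure) :
    MemLp (fun x => f (x / 2 + t)) q unitMeasure :=
  (hf.of_measure_le_smul (by simp) (map_half_le_unitMeasure ht)).comp_of_map (by fun_prop)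

/-- The rescaled restriction `x ↦ f (x / 2 + t)` of an `L^q` function to one half (`t = 0` or
`t = 1/2`) of the unit interval. -/
noncomputable def Lp.half (q : ℝ≥0∞) (ht : t = 0 ∨ t = 1 / 2) :
    Lp ℝ q unitMeasure →ₗ[ℝ] Lp ℝ q unitMeasure where
  toFun f := (memLp_comp_half ht (Lp.memLp f)).toLp _
  map_add' f g := by
    rw [← MemLp.toLp_add]
    exact MemLp.toLp_congr _ _ ((quasiMeasurePreserving_half ht).ae (Lp.coeFn_add f g))
  map_smul' c f := by
    rw [RingHom.id_apply, ← MemLp.toLp_const_smul]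
    exact MemLp.toLp_congr _ _ ((quasiMeasurePreserving_half ht).ae (Lp.coeFn_smul c f))

lemma Lp.coeFn_half (ht : t = 0 ∨ t = 1 / 2) (f : Lp ℝ q unitMeasure) {g : ℝ → ℝ}
    (hg : f =ᵐ[unitMeasure] g) : Lp.half q ht f =ᵐ[unitMeasure] fun x => g (x / 2 + t) :=
  (MemLp.coeFn_toLp (memLp_comp_half ht (Lp.memLp f))).trans
    ((quasiMeasurePreserving_half ht).ae hg)

lemma gammaFun_left {E : Type*} (f g : ℝ → E) :
    (fun x => gammaFun f g (x / 2 + 0)) =ᵐ[unitMeasure] f := by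
  filter_upwards [ae_unitMeasure_mem] with x hx
  have : x / 2 + 0 < 1 / 2 := by linarith [hx.2]
  rw [gammaFun, if_pos this]
  congr 1
  ring

lemma gammaFun_right {E : Type*} (f g : ℝ → E) :
    (fun x => gammaFun f g (x / 2 + 1 / 2)) =ᵐ[unitMeasure] g := by
  filter_upwards [ae_unitMeasure_mem] with x hx
  have : ¬ x / 2 + 1 / 2 < 1 / 2 := by linarith [hx.1]
  rw [gammaFun, if_neg this]
  congr 1
  ring

lemma lintegral_rpow_enorm_congr {f g : ℝ → ℝ} {r : ℝ} (h : f =ᵐ[unitMeasure] g) :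
    ∫⁻ x, ‖f x‖ₑ ^ r ∂unitMeasure = ∫⁻ x, ‖g x‖ₑ ^ r ∂unitMeasure :=
  lintegral_congr_ae (h.fun_comp fun y => ‖y‖ₑ ^ r)

lemma memLp_gammaFun [Fact (1 ≤ q)] (hq : q ≠ ∞) (f g : Lp ℝ q unitMeasure) :
    MemLp (gammaFun f g) q unitMeasure := by
  have hm : AEStronglyMeasurable (gammaFun f g) unitMeasure :=
    (StronglyMeasurable.ite (measurableSet_lt measurable_id measurable_const)
      ((Lp.stronglyMeasurable f).comp_measurable (by fun_prop))
      ((Lp.stronglyMeasurable g).comp_measurable (by fun_prop))).aestronglyMeasurable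
  have hq0 : q ≠ 0 := (zero_lt_one.trans_le Fact.out).ne'
  refine ⟨hm, ?_⟩
  rw [eLpNorm_lt_top_iff_lintegral_rpow_enorm_lt_top hq0 hq]
  have h := lintegral_unitMeasure_eq (hm.enorm.pow_const q.toReal)
  rw [lintegral_rpow_enorm_congr (gammaFun_left f g),
    lintegral_rpow_enorm_congr (gammaFun_right f g)] at h
  refine lt_of_le_of_lt (le_mul_of_one_le_left' one_le_two) (h.trans_lt ?_)
  exact ENNReal.add_lt_top.2
    ⟨lintegral_rpow_enorm_lt_top_of_eLpNorm_lt_top hq0 hq (Lp.eLpNorm_lt_top f),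
      lintegral_rpow_enorm_lt_top_of_eLpNorm_lt_top hq0 hq (Lp.eLpNorm_lt_top g)⟩

lemma Lp.ofReal_norm_rpow [Fact (1 ≤ q)] (hq : q ≠ ∞) (f : Lp ℝ q unitMeasure) :
    ENNReal.ofReal (‖f‖ ^ q.toReal) = ∫⁻ x, ‖f x‖ₑ ^ q.toReal ∂unitMeasure := by
  have hq0 : q ≠ 0 := (zero_lt_one.trans_le Fact.out).ne'
  have h := ENNReal.toReal_pos hq0 hq
  rw [← ENNReal.ofReal_rpow_of_nonneg (norm_nonneg _) h.le, Lp.norm_def,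
    ENNReal.ofReal_toReal (Lp.eLpNorm_ne_top f), eLpNorm_eq_lintegral_rpow_enorm_toReal hq0 hq,
    one_div, ENNReal.rpow_inv_rpow h.ne']

lemma Lp.norm_rpow_eq_half [Fact (1 ≤ q)] (hq : q ≠ ∞) (f : Lp ℝ q unitMeasure) :
    ‖f‖ ^ q.toReal =
      (‖Lp.half q (.inl rfl) f‖ ^ q.toReal + ‖Lp.half q (.inr rfl) f‖ ^ q.toReal) / 2 := by
  rw [eq_div_iff two_ne_zero, mul_comm, ← ENNReal.ofReal_eq_ofReal_iff (by positivity)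
    (by positivity), ENNReal.ofReal_mul zero_le_two, ENNReal.ofReal_add (by positivity)
    (by positivity), Lp.ofReal_norm_rpow hq, Lp.ofReal_norm_rpow hq,
    Lp.ofReal_norm_rpow hq, ENNReal.ofReal_ofNat,
    lintegral_unitMeasure_eq ((Lp.aestronglyMeasurable f).enorm.pow_const _),
    lintegral_rpow_enorm_congr (Lp.coeFn_half (.inl rfl) f .rfl),
    lintegral_rpow_enorm_congr (Lp.coeFn_half (.inr rfl) f .rfl)]

/-- Splitting an `L^q` function into its two rescaled halves is a linear isomorphism. -/
noncomputable def Lp.splitEquiv [Fact (1 ≤ q)] (hq : q ≠ ∞) :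
    Lp ℝ q unitMeasure ≃ₗ[ℝ] Lp ℝ q unitMeasure × Lp ℝ q unitMeasure :=
  LinearEquiv.ofBijective ((Lp.half q (.inl rfl)).prod (Lp.half q (.inr rfl))) <| by
    constructor
    · rw [← LinearMap.ker_eq_bot, LinearMap.ker_eq_bot']
      intro f hf
      have h0 := ENNReal.toReal_pos (zero_lt_one.trans_le (Fact.out : 1 ≤ q)).ne' hq
      replace hf := Prod.mk_eq_zero.1 hf
      have h := Lp.norm_rpow_eq_half hq f
      rw [hf.1, hf.2, norm_zero, Real.zero_rpow h0.ne', add_zero, zero_div,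
        Real.rpow_eq_zero (norm_nonneg _) h0.ne'] at h
      exact norm_eq_zero.1 h
    · rintro ⟨f, g⟩
      have hγ := (memLp_gammaFun hq f g).coeFn_toLp
      exact ⟨(memLp_gammaFun hq f g).toLp _, Prod.ext
        (Lp.ext ((Lp.coeFn_half (.inl rfl) _ hγ).trans (gammaFun_left f g)))
        (Lp.ext ((Lp.coeFn_half (.inr rfl) _ hγ).trans (gammaFun_right f g)))⟩

lemma Lp.half_zero_splitEquiv_symm [Fact (1 ≤ q)] (hq : q ≠ ∞)
    (z : Lp ℝ q unitMeasure × Lp ℝ q unitMeasure) :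
    Lp.half q (.inl rfl) ((Lp.splitEquiv hq).symm z) = z.1 :=
  congrArg Prod.fst ((Lp.splitEquiv hq).apply_symm_apply z)

lemma Lp.half_one_half_splitEquiv_symm [Fact (1 ≤ q)] (hq : q ≠ ∞)
    (z : Lp ℝ q unitMeasure × Lp ℝ q unitMeasure) :
    Lp.half q (.inr rfl) ((Lp.splitEquiv hq).symm z) = z.2 :=
  congrArg Prod.snd ((Lp.splitEquiv hq).apply_symm_apply z)

lemma Lp.splitEquiv_symm_eq_iff [Fact (1 ≤ q)] (hq : q ≠ ∞) (f g h : Lp ℝ q unitMeasure) :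
    (Lp.splitEquiv hq).symm (f, g) = h ↔ h =ᵐ[unitMeasure] gammaFun f g := by
  have key (k : Lp ℝ q unitMeasure) (hk : k =ᵐ[unitMeasure] gammaFun f g) :
      (Lp.splitEquiv hq).symm (f, g) = k := by
    rw [LinearEquiv.symm_apply_eq]
    exact Prod.ext
      (Lp.ext ((Lp.coeFn_half (.inl rfl) _ hk).trans (gammaFun_left f g))).symm
      (Lp.ext ((Lp.coeFn_half (.inr rfl) _ hk).trans (gammaFun_right f g))).symm
  refine ⟨?_, key h⟩
  rintro rfl
  have hγ := (memLp_gammaFun hq f g).coeFn_toLp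
  rw [key _ hγ]
  exact hγ

lemma Lp.norm_splitEquiv_symm [Fact (1 ≤ q)] (hq : q ≠ ∞) (f g : Lp ℝ q unitMeasure) :
    ‖(Lp.splitEquiv hq).symm (f, g)‖ =
      ((‖f‖ ^ q.toReal + ‖g‖ ^ q.toReal) / 2) ^ (1 / q.toReal) := by
  have h0 := ENNReal.toReal_pos (zero_lt_one.trans_le (Fact.out : 1 ≤ q)).ne' hq
  have h := Lp.norm_rpow_eq_half hq ((Lp.splitEquiv hq).symm (f, g))
  rw [Lp.half_zero_splitEquiv_symm, Lp.half_one_half_splitEquiv_symm] at h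
  rw [← h, one_div, Real.rpow_rpow_inv (norm_nonneg _) h0.ne']

lemma Lp.half_const (ht : t = 0 ∨ t = 1 / 2) (c : ℝ) :
    Lp.half q ht (Lp.const q unitMeasure c) = Lp.const q unitMeasure c :=
  Lp.ext ((Lp.coeFn_half ht _ (Lp.coeFn_const q unitMeasure c)).trans
    (Lp.coeFn_const q unitMeasure c).symm)

lemma Lp.norm_le_of_ae_unitMeasure_bound [Fact (1 ≤ q)] {f : Lp ℝ q unitMeasure} {C : ℝ}
    (hC : 0 ≤ C) (h : ∀ᵐ x ∂unitMeasure, ‖f x‖ ≤ C) : ‖f‖ ≤ C := by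
  simpa [measureUnivNNReal] using Lp.norm_le_of_ae_bound hC h

lemma Lp.norm_const_one_unitMeasure [Fact (1 ≤ q)] (hq : q ≠ ∞) :
    ‖Lp.const q unitMeasure (1 : ℝ)‖ = 1 := by
  refine (Lp.norm_const' q unitMeasure (1 : ℝ)
    (zero_lt_one.trans_le (Fact.out : 1 ≤ q)).ne' hq).trans ?_
  simp

lemma Lp.norm_splitApprox_sub_le [Fact (1 ≤ q)] (hq : q ≠ ∞) {φ : Lp ℝ q unitMeasure →ₗ[ℝ] ℝ}
    (hφ : ∀ f, |φ f| ≤ ‖f‖) (hφ1 : φ (Lp.const q unitMeasure 1) = 1) {ε : ℝ} (hε : 0 ≤ ε) (n : ℕ)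
    {f : Lp ℝ q unitMeasure} {g : ℝ → ℝ} (hfg : f =ᵐ[unitMeasure] g)
    (hg : ∀ x ∈ Set.Icc (0 : ℝ) 1, ∀ y ∈ Set.Icc (0 : ℝ) 1, |x - y| ≤ (1 / 2) ^ n →
      |g x - g y| ≤ ε) :
    ‖splitApprox (Lp.half q (.inl rfl)) (Lp.half q (.inr rfl)) φ (Lp.const q unitMeasure 1)
      (Lp.splitEquiv hq).symm n f - f‖ ≤ 2 * ε := by
  induction n generalizing f g with
  | zero =>
    set one := Lp.const q unitMeasure (1 : ℝ)
    have hone : ‖one‖ ≤ 1 := (Lp.norm_const_one_unitMeasure hq).le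
    have hd : ‖f - g 0 • one‖ ≤ ε := by
      refine Lp.norm_le_of_ae_unitMeasure_bound hε ?_
      filter_upwards [Lp.coeFn_sub f (g 0 • one), Lp.coeFn_smul (g 0) one,
        Lp.coeFn_const q unitMeasure (1 : ℝ), hfg, ae_unitMeasure_mem] with x h1 h2 h3 h4 hx
      rw [h1, Pi.sub_apply, h2, Pi.smul_apply, h3, h4, Function.const_apply, smul_eq_mul, mul_one]
      exact hg x ⟨hx.1, hx.2.le⟩ 0 (by simp) (by simpa [abs_of_nonneg hx.1] using hx.2.le)
    have heq : φ f • one - f = φ (f - g 0 • one) • one - (f - g 0 • one) := by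
      rw [map_sub, map_smul, hφ1, smul_eq_mul, mul_one, sub_smul]
      abel
    rw [splitApprox_zero, heq]
    refine (norm_sub_le _ _).trans ?_
    rw [norm_smul, Real.norm_eq_abs]
    have := mul_le_mul ((hφ _).trans hd) hone (norm_nonneg _) hε
    linarith
  | succ n ih =>
    have hf (t : ℝ) (ht : t = 0 ∨ t = 1 / 2) := ih (Lp.coeFn_half ht f hfg) <| by
      have ht' : 0 ≤ t ∧ t ≤ 1 / 2 := by obtain rfl | rfl := ht <;> norm_num
      rintro x ⟨hx0, hx1⟩ y ⟨hy0, hy1⟩ hxy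
      refine hg _ ⟨by linarith, by linarith⟩ _ ⟨by linarith, by linarith⟩ ?_
      rw [add_sub_add_right_eq_sub, ← sub_div, abs_div, abs_two, pow_succ]
      linarith
    have h0 := ENNReal.toReal_pos (zero_lt_one.trans_le (Fact.out : 1 ≤ q)).ne' hq
    rw [← Real.rpow_le_rpow_iff (norm_nonneg _) (by positivity) h0, Lp.norm_rpow_eq_half hq,
      map_sub, map_sub, splitApprox_succ]
    simp only [LinearEquiv.coe_coe]
    rw [Lp.half_zero_splitEquiv_symm, Lp.half_one_half_splitEquiv_symm]
    have hl := Real.rpow_le_rpow (norm_nonneg _) (hf 0 (.inl rfl)) h0.le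
    have hr := Real.rpow_le_rpow (norm_nonneg _) (hf _ (.inr rfl)) h0.le
    linarith

lemma Lp.tendsto_splitApprox [Fact (1 ≤ q)] (hq : q ≠ ∞) {φ : Lp ℝ q unitMeasure →ₗ[ℝ] ℝ}
    (hφ : ∀ f, |φ f| ≤ ‖f‖) (hφ1 : φ (Lp.const q unitMeasure 1) = 1) (f : Lp ℝ q unitMeasure) :
    Tendsto (fun n => splitApprox (Lp.half q (.inl rfl)) (Lp.half q (.inr rfl)) φ
      (Lp.const q unitMeasure 1) (Lp.splitEquiv hq).symm n f) atTop (𝓝 f) := by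
  have h0 := ENNReal.toReal_pos (zero_lt_one.trans_le (Fact.out : 1 ≤ q)).ne' hq
  rw [Metric.tendsto_atTop]
  intro ε hε
  obtain ⟨g, hgc, hfg, hg, hgm⟩ := (Lp.memLp f).exists_hasCompactSupport_eLpNorm_sub_le hq
    (ε := ENNReal.ofReal (ε / 5)) (by simpa using hε)
  set k := hgm.toLp g
  have hfk : ‖f - k‖ ≤ ε / 5 := by
    rw [← Lp.toLp_coeFn f (Lp.memLp f), ← MemLp.toLp_sub, Lp.norm_toLp]
    exact ENNReal.toReal_le_of_le_ofReal (by positivity) hfg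
  obtain ⟨d, hd, hgd⟩ := Metric.uniformContinuous_iff.1 (hgc.uniformContinuous_of_continuous hg)
    (ε / 5) (by positivity)
  obtain ⟨N, hN⟩ := exists_pow_lt_of_lt_one hd (by norm_num : (1 / 2 : ℝ) < 1)
  refine ⟨N, fun n hn => ?_⟩
  have hk := Lp.norm_splitApprox_sub_le hq hφ hφ1 (ε := ε / 5) (by positivity) n hgm.coeFn_toLp
    fun x _ y _ hxy => by
      have hlt : |x - y| < d :=
        (hxy.trans (pow_le_pow_of_le_one (by norm_num) (by norm_num) hn)).trans_lt hN
      exact (hgd hlt).le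
  have hb := norm_splitApprox_le h0 (Lp.norm_rpow_eq_half hq) hφ
    (v := Lp.const q unitMeasure (1 : ℝ)) (δ := (Lp.splitEquiv hq).symm)
    (fun x y => (Lp.norm_splitEquiv_symm hq x y).le) n (f - k)
  rw [map_sub, Lp.norm_const_one_unitMeasure hq, mul_one] at hb
  set S := splitApprox (Lp.half q (.inl rfl)) (Lp.half q (.inr rfl)) φ
    (Lp.const q unitMeasure (1 : ℝ)) (Lp.splitEquiv hq).symm n
  calc dist (S f) f = ‖(S f - S k) + (S k - k) + (k - f)‖ := by rw [dist_eq_norm]; congr 1; abel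
    _ ≤ ‖S f - S k‖ + ‖S k - k‖ + ‖k - f‖ := norm_add₃_le
    _ < ε := by rw [norm_sub_rev k f]; linarith

end Lp

/-- for a real Banach space `V`, `v ∈ V`, and an ℝ-linear
`δ : V × V → V` with `δ(v,v) = v` and `‖δ(x,y)‖ ≤ ((‖x‖^p + ‖y‖^p)/2)^{1/p}`, there is a
unique continuous linear map `θ : L^p([0,1];ℝ) → V` with `θ(1) = v` and
`θ(γ(f,g)) = δ(θ(f), θ(g))`. -/
theorem initial_object_property_Lp
    (p : ℝ) (hp : 1 ≤ p) [Fact (1 ≤ ENNReal.ofReal p)]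
    (V : Type*) [NormedAddCommGroup V] [NormedSpace ℝ V] [CompleteSpace V]
    (v : V) (δ : (V × V) →ₗ[ℝ] V) (hδv : δ (v, v) = v)
    (hδnorm : ∀ x y : V, ‖δ (x, y)‖ ≤ ((‖x‖ ^ p + ‖y‖ ^ p) / 2) ^ (1 / p)) :
    ∃! θ : Lp ℝ (ENNReal.ofReal p) unitMeasure →L[ℝ] V,
      (∀ one : Lp ℝ (ENNReal.ofReal p) unitMeasure,
        ⇑one =ᵐ[unitMeasure] (fun _ => (1 : ℝ)) → θ one = v) ∧
      (∀ f g h : Lp ℝ (ENNReal.ofReal p) unitMeasure,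
        ⇑h =ᵐ[unitMeasure] gammaFun ⇑f ⇑g → θ h = δ (θ f, θ g)) := by
  have hq : ENNReal.ofReal p ≠ ∞ := ENNReal.ofReal_ne_top
  have hpq : (ENNReal.ofReal p).toReal = p := ENNReal.toReal_ofReal (by linarith)
  set one := Lp.const (ENNReal.ofReal p) unitMeasure (1 : ℝ)
  have hone_coe : one =ᵐ[unitMeasure] fun _ => (1 : ℝ) := Lp.coeFn_const _ _ _
  obtain ⟨φ, hφ, hφ1⟩ := exists_dual_vector'' ℝ one
  have hφ' (f : Lp ℝ (ENNReal.ofReal p) unitMeasure) : |φ f| ≤ ‖f‖ := by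
    simpa using φ.le_of_opNorm_le hφ f
  rw [Lp.norm_const_one_unitMeasure hq, RCLike.ofReal_one] at hφ1
  have hsplit := Lp.norm_rpow_eq_half hq
  rw [hpq] at hsplit
  have key := existsUnique_of_tendsto_splitApprox (φ := φ.toLinearMap) (one := one)
    (γ := (Lp.splitEquiv hq).symm) (by linarith) hsplit hφ' (Lp.half_const _ 1) (Lp.half_const _ 1)
    hφ1 (Lp.half_zero_splitEquiv_symm hq) (Lp.half_one_half_splitEquiv_symm hq)
    (Lp.tendsto_splitApprox hq hφ' hφ1) hδv hδnorm
  refine (existsUnique_congr fun θ => and_congr ⟨fun h o ho => ?_, fun h => h one hone_coe⟩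
    ⟨fun h f g k hk => ?_, fun h z => ?_⟩).1 key
  · rw [Lp.ext (ho.trans hone_coe.symm), h]
  · rw [← (Lp.splitEquiv_symm_eq_iff hq f g k).2 hk]
    exact h (f, g)
  · exact h z.1 z.2 _ ((Lp.splitEquiv_symm_eq_iff hq z.1 z.2 _).1 rfl)
end

section
/- Let V be a real Banach space equipped with a right B-module structure satisfying ‖x·b‖ ≤ ‖x‖·‖b‖ for all x ∈ V, b ∈ B. Let v ∈ V and let δ : V^{2^n} → V be an ℝ-linear, right B-linear map such that δ(v, …, v) = v and ‖δ((x_σ)_σ)‖ ≤ 2^{-n} ∑_{σ∈{0,1}^n} ‖x_σ‖ for all (x_σ)_σ ∈ V^{2^n}. Then there exists a unique continuous ℝ-linear, right B-linear map θ : L¹([0,1)^n; B) → V such that θ(const 1_B) = v (where const 1_B is the constant function with value the unit of B) and θ(Γ((f_σ)_σ)) = δ((θ(f_σ))_σ) for every 2^n-tuple (f_σ)_σ in L¹([0,1)^n; B). -/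
open MeasureTheory

/-- Lebesgue measure restricted to the half-open unit cube `[0,1)^n`. -/
noncomputable def cubeMeasure (n : ℕ) : Measure (Fin n → ℝ) :=
  volume.restrict (Set.univ.pi fun _ => Set.Ico (0:ℝ) 1)

/-- The juxtaposition of a `2^n`-tuple of functions: on the subcube `C_σ` indexed by
`σ ∈ {0,1}^n` it takes the value `f_σ(2y − σ)`. -/
noncomputable def juxtFun {n : ℕ} {B : Type*} (F : (Fin n → Bool) → (Fin n → ℝ) → B)
    (y : Fin n → ℝ) : B :=
  F (fun j => if (1/2 : ℝ) ≤ y j then true else false)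
    (fun j => 2 * y j - (if (1/2 : ℝ) ≤ y j then 1 else 0))

instance (n : ℕ) : IsProbabilityMeasure (cubeMeasure n) := by
  constructor
  rw [cubeMeasure, Measure.restrict_apply_univ, volume_pi_pi]
  simp

/-- The affine bijection `x ↦ (x + σ) / 2` from the unit cube onto the subcube `C_σ`. -/
noncomputable def subcubeMap {n : ℕ} (σ : Fin n → Bool) (x : Fin n → ℝ) : Fin n → ℝ :=
  (2⁻¹ : ℝ) • (x + fun j => if σ j then 1 else 0)

theorem subcubeMap_measurableEmbedding {n : ℕ} (σ : Fin n → Bool) :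
    MeasurableEmbedding (subcubeMap σ) :=
  (measurableEmbedding_const_smul₀ (α := Fin n → ℝ) (c := (2⁻¹ : ℝ)) (by norm_num)).comp
    (measurableEmbedding_addRight _)

theorem dist_subcubeMap {n : ℕ} (σ : Fin n → Bool) (x y : Fin n → ℝ) :
    dist (subcubeMap σ x) (subcubeMap σ y) = dist x y / 2 := by
  rw [subcubeMap, subcubeMap, dist_smul₀, dist_add_right]
  norm_num
  ring

theorem subcubeMap_mem_cube_iff {n : ℕ} (σ : Fin n → Bool) (x : Fin n → ℝ) :
    (subcubeMap σ x ∈ (Set.univ.pi fun _ => Set.Ico (0:ℝ) 1) ∧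
      (fun j => if (1/2 : ℝ) ≤ subcubeMap σ x j then true else false) = σ) ↔
    x ∈ Set.univ.pi fun _ => Set.Ico (0:ℝ) 1 := by
  simp only [Set.mem_univ_pi, funext_iff, ← forall_and, subcubeMap, Set.mem_Ico, Pi.smul_apply,
    Pi.add_apply, smul_eq_mul]
  refine forall_congr' fun j => ?_
  obtain hσ | hσ := (σ j).eq_false_or_eq_true <;> simp only [hσ] <;> grind

theorem juxtFun_subcubeMap {n : ℕ} {B : Type*} (F : (Fin n → Bool) → (Fin n → ℝ) → B)
    (σ : Fin n → Bool) {x : Fin n → ℝ} (hx : x ∈ Set.univ.pi fun _ => Set.Ico (0:ℝ) 1) :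
    juxtFun F (subcubeMap σ x) = F σ x := by
  have h := ((subcubeMap_mem_cube_iff σ x).2 hx).2
  rw [juxtFun, h]
  congr 1
  funext j
  have hj := congrFun h j
  simp only [subcubeMap, Pi.smul_apply, Pi.add_apply, smul_eq_mul] at hj ⊢
  obtain hσ | hσ := (σ j).eq_false_or_eq_true <;> simp only [hσ] at hj ⊢ <;> grind

theorem map_subcubeMap_volume {n : ℕ} (σ : Fin n → Bool) :
    Measure.map (subcubeMap σ) volume = (2 : ENNReal) ^ n • volume := by
  have h : subcubeMap σ = (fun x : Fin n → ℝ => (2⁻¹ : ℝ) • x) ∘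
      (fun x => x + fun j => if σ j then 1 else 0) := rfl
  rw [h, ← Measure.map_map (by fun_prop) (by fun_prop), map_add_right_eq_self,
    Measure.map_addHaar_smul _ (by norm_num)]
  congr 1
  simp [ENNReal.ofReal_pow]

/-- Self-similarity of Lebesgue measure on the unit cube. -/
theorem sum_map_subcubeMap (n : ℕ) :
    ∑ σ : Fin n → Bool, Measure.map (subcubeMap σ) (cubeMeasure n) =
      (2 : ENNReal) ^ n • cubeMeasure n := by
  set Q : Set (Fin n → ℝ) := Set.univ.pi fun _ => Set.Ico (0:ℝ) 1 with hQ
  let c : (Fin n → ℝ) → Fin n → Bool := fun y j => if (1/2 : ℝ) ≤ y j then true else false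
  have hc : Measurable c := by
    refine measurable_pi_lambda _ fun j => ?_
    exact Measurable.ite (measurableSet_le measurable_const (measurable_pi_apply j))
      measurable_const measurable_const
  have hQm : MeasurableSet Q := MeasurableSet.univ_pi fun _ => measurableSet_Ico
  have hmap (σ : Fin n → Bool) : Measure.map (subcubeMap σ) (cubeMeasure n) =
      (2 : ENNReal) ^ n • volume.restrict (Q ∩ c ⁻¹' {σ}) := by
    rw [← Measure.restrict_smul, ← map_subcubeMap_volume σ,
      (subcubeMap_measurableEmbedding σ).restrict_map, cubeMeasure]
    congr 2
    ext x
    exact (subcubeMap_mem_cube_iff σ x).symm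
  simp_rw [hmap]
  rw [← Finset.smul_sum, ← Measure.sum_fintype, ← Measure.restrict_iUnion]
  · rw [← Set.inter_iUnion, cubeMeasure]
    congr 3
    ext y
    simp [hQ]
  · intro σ τ hστ
    refine Set.disjoint_left.2 fun y hy hy' => hστ ?_
    exact hy.2.symm.trans hy'.2
  · exact fun σ => hQm.inter (hc (measurableSet_singleton σ))

theorem ae_cubeMeasure_iff {n : ℕ} {p : (Fin n → ℝ) → Prop} :
    (∀ᵐ y ∂cubeMeasure n, p y) ↔ ∀ σ, ∀ᵐ x ∂cubeMeasure n, p (subcubeMap σ x) := by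
  rw [← Measure.ae_ennreal_smul_measure_iff (c := (2 : ENNReal) ^ n) (by simp),
    ← sum_map_subcubeMap, ae_finsetSum_measure_iff]
  simp [(subcubeMap_measurableEmbedding _).ae_map_iff]

theorem integrable_cubeMeasure_iff {n : ℕ} {B : Type*} [NormedAddCommGroup B]
    {f : (Fin n → ℝ) → B} :
    Integrable f (cubeMeasure n) ↔ ∀ σ, Integrable (f ∘ subcubeMap σ) (cubeMeasure n) := by
  rw [← integrable_smul_measure (c := (2 : ENNReal) ^ n) (by simp) (by simp),
    ← sum_map_subcubeMap, integrable_finsetSum_measure]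
  simp [(subcubeMap_measurableEmbedding _).integrable_map_iff]

theorem sum_integral_subcubeMap {n : ℕ} {B : Type*} [NormedAddCommGroup B] [NormedSpace ℝ B]
    {f : (Fin n → ℝ) → B} (hf : Integrable f (cubeMeasure n)) :
    ∑ σ, ∫ x, f (subcubeMap σ x) ∂cubeMeasure n = (2 : ℝ) ^ n • ∫ y, f y ∂cubeMeasure n := by
  have h := integral_finsetSum_measure (f := f) (s := Finset.univ)
    (μ := fun σ : Fin n → Bool => Measure.map (subcubeMap σ) (cubeMeasure n)) fun σ _ =>
      (subcubeMap_measurableEmbedding σ).integrable_map_iff.2 (integrable_cubeMeasure_iff.1 hf σ)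
  rw [sum_map_subcubeMap, integral_smul_measure] at h
  simpa [(subcubeMap_measurableEmbedding _).integral_map] using h.symm

theorem juxtFun_comp_subcubeMap_ae_eq {n : ℕ} {B : Type*}
    (F : (Fin n → Bool) → (Fin n → ℝ) → B)
    (σ : Fin n → Bool) : juxtFun F ∘ subcubeMap σ =ᵐ[cubeMeasure n] F σ := by
  filter_upwards [ae_restrict_mem (MeasurableSet.univ_pi fun _ => measurableSet_Ico)] with x hx
  exact juxtFun_subcubeMap F σ hx

theorem integrable_comp_subcubeMap {n : ℕ} {B : Type*} [NormedAddCommGroup B]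
    (f : Lp B 1 (cubeMeasure n)) (σ : Fin n → Bool) :
    Integrable (f ∘ subcubeMap σ) (cubeMeasure n) :=
  integrable_cubeMeasure_iff.1 (L1.integrable_coeFn f) σ

theorem sum_norm_toL1_comp_subcubeMap {n : ℕ} {B : Type*} [NormedAddCommGroup B]
    (f : Lp B 1 (cubeMeasure n)) :
    ∑ σ, ‖(integrable_comp_subcubeMap f σ).toL1 _‖ = (2 : ℝ) ^ n * ‖f‖ := by
  rw [L1.norm_eq_integral_norm, ← smul_eq_mul,
    ← sum_integral_subcubeMap (L1.integrable_coeFn f).norm]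
  simp_rw [L1.norm_of_fun_eq_integral_norm]
  rfl

section Restriction

variable {n : ℕ} {B : Type*} [NormedAddCommGroup B] [NormedSpace ℝ B]

/-- Restriction of an `L¹` function to the subcube `C_σ`, rescaled to the unit cube. -/
noncomputable def subcubeRestrict (σ : Fin n → Bool) :
    Lp B 1 (cubeMeasure n) →L[ℝ] Lp B 1 (cubeMeasure n) :=
  LinearMap.mkContinuous
    { toFun := fun f => (integrable_comp_subcubeMap f σ).toL1 _
      map_add' := fun f g => by
        rw [← Integrable.toL1_add]
        exact (Integrable.toL1_eq_toL1_iff _ _ _ _).2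
          (ae_cubeMeasure_iff.1 (Lp.coeFn_add f g) σ)
      map_smul' := fun c f => by
        rw [RingHom.id_apply, ← Integrable.toL1_smul]
        exact (Integrable.toL1_eq_toL1_iff _ _ _ _).2
          (ae_cubeMeasure_iff.1 (Lp.coeFn_smul c f) σ) }
    ((2 : ℝ) ^ n) fun f => by
      rw [← sum_norm_toL1_comp_subcubeMap f]
      exact Finset.single_le_sum
        (f := fun σ => ‖(integrable_comp_subcubeMap f σ).toL1 (f ∘ subcubeMap σ)‖)
        (fun τ _ => norm_nonneg _) (Finset.mem_univ σ)

theorem coeFn_subcubeRestrict (σ : Fin n → Bool) (f : Lp B 1 (cubeMeasure n)) :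
    subcubeRestrict σ f =ᵐ[cubeMeasure n] fun x => f (subcubeMap σ x) :=
  (integrable_comp_subcubeMap f σ).coeFn_toL1

theorem sum_norm_subcubeRestrict (f : Lp B 1 (cubeMeasure n)) :
    ∑ σ, ‖subcubeRestrict σ f‖ = (2 : ℝ) ^ n * ‖f‖ :=
  sum_norm_toL1_comp_subcubeMap f

theorem subcubeRestrict_ae_eq {f : Lp B 1 (cubeMeasure n)} {g : (Fin n → ℝ) → B}
    (h : f =ᵐ[cubeMeasure n] g) (σ : Fin n → Bool) :
    subcubeRestrict σ f =ᵐ[cubeMeasure n] fun x => g (subcubeMap σ x) :=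
  (coeFn_subcubeRestrict σ f).trans (ae_cubeMeasure_iff.1 h σ)

theorem ae_eq_juxtFun_iff {h : Lp B 1 (cubeMeasure n)}
    {F : (Fin n → Bool) → Lp B 1 (cubeMeasure n)} :
    h =ᵐ[cubeMeasure n] juxtFun (fun σ => ⇑(F σ)) ↔ ∀ σ, subcubeRestrict σ h = F σ := by
  rw [Filter.EventuallyEq, ae_cubeMeasure_iff]
  refine forall_congr' fun σ => ?_
  have hF := juxtFun_comp_subcubeMap_ae_eq (fun σ => ⇑(F σ)) σ
  exact ⟨fun H => Lp.ext ((coeFn_subcubeRestrict σ h).trans (Filter.EventuallyEq.trans H hF)),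
    fun H => ((coeFn_subcubeRestrict σ h).symm.trans (by rw [H])).trans hF.symm⟩

theorem exists_subcubeRestrict_eq (F : (Fin n → Bool) → Lp B 1 (cubeMeasure n)) :
    ∃ h : Lp B 1 (cubeMeasure n), ∀ σ, subcubeRestrict σ h = F σ := by
  have hi : Integrable (juxtFun fun σ => ⇑(F σ)) (cubeMeasure n) :=
    integrable_cubeMeasure_iff.2 fun σ =>
      (L1.integrable_coeFn (F σ)).congr (juxtFun_comp_subcubeMap_ae_eq (fun σ => ⇑(F σ)) σ).symm
  exact ⟨hi.toL1 _, ae_eq_juxtFun_iff.1 hi.coeFn_toL1⟩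

/-- The `L¹` functions that are constant on each dyadic subcube of side `2⁻ᵏ`. -/
def dyadicStep (n : ℕ) (B : Type*) [NormedAddCommGroup B] [NormedSpace ℝ B] :
    ℕ → Set (Lp B 1 (cubeMeasure n))
  | 0 => {f | ∃ b : B, f =ᵐ[cubeMeasure n] fun _ => b}
  | k + 1 => {f | ∀ σ, subcubeRestrict σ f ∈ dyadicStep n B k}

theorem exists_dyadicStep_near (k : ℕ) : ∀ (f : Lp B 1 (cubeMeasure n)) (c : (Fin n → ℝ) → B)
    (ε δ : ℝ), f =ᵐ[cubeMeasure n] c → (∀ x y, dist x y < δ → dist (c x) (c y) ≤ ε) →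
    1 < 2 ^ k * δ → ∃ g ∈ dyadicStep n B k, ‖f - g‖ ≤ ε := by
  induction k with
  | zero =>
    intro f c ε δ hfc hc hδ
    have hi : Integrable (fun _ => c 0) (cubeMeasure n) := integrable_const _
    refine ⟨hi.toL1 _, ⟨c 0, hi.coeFn_toL1⟩, ?_⟩
    have hε : 0 ≤ ε := dist_nonneg.trans (hc 0 0 (by rw [dist_self]; linarith))
    refine (Lp.norm_le_of_ae_bound hε ?_).trans_eq (by simp [measureUnivNNReal])
    filter_upwards [Lp.coeFn_sub f (hi.toL1 _), hfc, hi.coeFn_toL1,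
      ae_restrict_mem (MeasurableSet.univ_pi fun _ => measurableSet_Ico)] with x h1 h2 h3 hx
    rw [h1, Pi.sub_apply, h2, h3, ← dist_eq_norm]
    refine hc _ _ (lt_of_le_of_lt ?_ (by linarith : 1 < δ))
    refine (dist_pi_le_iff zero_le_one).2 fun j => ?_
    have := hx j (Set.mem_univ j)
    rw [Pi.zero_apply, Real.dist_eq, sub_zero, abs_of_nonneg this.1]
    exact this.2.le
  | succ k ih =>
    intro f c ε δ hfc hc hδ
    have H (σ : Fin n → Bool) := ih (subcubeRestrict σ f) (fun x => c (subcubeMap σ x)) ε (2 * δ)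
      (subcubeRestrict_ae_eq hfc σ)
      (fun x y hxy => hc _ _ (by rw [dist_subcubeMap]; linarith)) (by rw [pow_succ] at hδ; linarith)
    choose G hG hfG using H
    obtain ⟨g, hg⟩ := exists_subcubeRestrict_eq G
    refine ⟨g, fun σ => by rw [hg]; exact hG σ, ?_⟩
    refine le_of_mul_le_mul_left ?_ (show (0 : ℝ) < 2 ^ n by positivity)
    rw [← sum_norm_subcubeRestrict]
    refine (Finset.sum_le_sum fun σ _ => ?_).trans_eq (b := ∑ _σ : Fin n → Bool, ε) (by simp)
    rw [map_sub, hg]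
    exact hfG σ

theorem dense_iUnion_dyadicStep : Dense (⋃ k, dyadicStep n B k) := by
  refine Metric.dense_iff.2 fun f r hr => ?_
  have : (cubeMeasure n).Regular := inferInstance
  obtain ⟨c, hcs, hfc, hcc, hcm⟩ := (Lp.memLp f).exists_hasCompactSupport_eLpNorm_sub_le
    ENNReal.one_ne_top (ε := ENNReal.ofReal (r / 3)) (by simpa using hr)
  obtain ⟨δ, hδ, hc⟩ := Metric.uniformContinuous_iff.1
    (hcs.uniformContinuous_of_continuous hcc) (r / 3) (by positivity)
  obtain ⟨k, hk⟩ := pow_unbounded_of_one_lt δ⁻¹ one_lt_two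
  obtain ⟨g, hg, hcg⟩ := exists_dyadicStep_near k (hcm.toLp c) c (r / 3) δ hcm.coeFn_toLp
    (fun x y hxy => (hc hxy).le) ((inv_lt_iff_one_lt_mul₀ hδ).1 hk)
  refine ⟨g, ?_, Set.mem_iUnion.2 ⟨k, hg⟩⟩
  have h1 : ‖f - hcm.toLp c‖ ≤ r / 3 := by
    conv_lhs => rw [← Lp.toLp_coeFn f (Lp.memLp f)]
    rw [← MemLp.toLp_sub, Lp.norm_toLp]
    exact ENNReal.toReal_le_of_le_ofReal (by positivity) hfc
  rw [Metric.mem_ball, dist_comm, dist_eq_norm]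
  linarith [norm_sub_le_norm_sub_add_norm_sub f (hcm.toLp c) g]

end Restriction

section Iteration

variable {n : ℕ} {B : Type*} [NormedAddCommGroup B] [NormedSpace ℝ B]
  {V : Type*} [NormedAddCommGroup V] [NormedSpace ℝ V]

/-- The operator `θ ↦ (f ↦ δ (θ (f restricted to C_σ))_σ)` whose fixed points are the maps
intertwining juxtaposition with `δ`. -/
noncomputable def juxtStep (δ : ((Fin n → Bool) → V) →L[ℝ] V)
    (θ : Lp B 1 (cubeMeasure n) →L[ℝ] V) : Lp B 1 (cubeMeasure n) →L[ℝ] V :=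
  δ.comp (ContinuousLinearMap.pi fun σ => θ.comp (subcubeRestrict σ))

theorem juxtStep_apply (δ : ((Fin n → Bool) → V) →L[ℝ] V)
    (θ : Lp B 1 (cubeMeasure n) →L[ℝ] V) (f : Lp B 1 (cubeMeasure n)) :
    juxtStep δ θ f = δ fun σ => θ (subcubeRestrict σ f) := rfl

theorem norm_iterate_juxtStep_le {δ : ((Fin n → Bool) → V) →L[ℝ] V}
    (hδ : ∀ x, ‖δ x‖ ≤ ((2 : ℝ) ^ n)⁻¹ * ∑ σ, ‖x σ‖) (w : Lp B 1 (cubeMeasure n) →L[ℝ] V)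
    (k : ℕ) : ‖(juxtStep δ)^[k] w‖ ≤ ‖w‖ := by
  induction k with
  | zero => rfl
  | succ k ih =>
    rw [Function.iterate_succ_apply']
    refine ContinuousLinearMap.opNorm_le_bound _ (norm_nonneg _) fun f => ?_
    rw [juxtStep_apply]
    refine (hδ _).trans ((inv_mul_le_iff₀ (by positivity)).2 ?_)
    rw [mul_left_comm, ← sum_norm_subcubeRestrict, Finset.mul_sum]
    exact Finset.sum_le_sum fun σ _ => ContinuousLinearMap.le_of_opNorm_le _ ih _

theorem iterate_juxtStep_succ_eq {δ : ((Fin n → Bool) → V) →L[ℝ] V}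
    {w : Lp B 1 (cubeMeasure n) →L[ℝ] V} (hw : ∀ f ∈ dyadicStep n B 0, juxtStep δ w f = w f)
    (k : ℕ) : ∀ f ∈ dyadicStep n B k, (juxtStep δ)^[k + 1] w f = (juxtStep δ)^[k] w f := by
  induction k with
  | zero => exact hw
  | succ k ih =>
    intro f hf
    simp only [Function.iterate_succ_apply'] at ih ⊢
    rw [juxtStep_apply, juxtStep_apply δ ((juxtStep δ)^[k] w)]
    exact congrArg δ (funext fun σ => ih _ (hf σ))

theorem dyadicStep_mono : Monotone (dyadicStep n B) := by
  refine monotone_nat_of_le_succ fun k => ?_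
  induction k with
  | zero => exact fun f ⟨b, hb⟩ σ => ⟨b, subcubeRestrict_ae_eq hb σ⟩
  | succ k ih => exact fun f hf σ => ih (hf σ)

theorem iterate_juxtStep_eq {δ : ((Fin n → Bool) → V) →L[ℝ] V}
    {w : Lp B 1 (cubeMeasure n) →L[ℝ] V} (hw : ∀ f ∈ dyadicStep n B 0, juxtStep δ w f = w f)
    {k j : ℕ} (hkj : k ≤ j) {f : Lp B 1 (cubeMeasure n)} (hf : f ∈ dyadicStep n B k) :
    (juxtStep δ)^[j] w f = (juxtStep δ)^[k] w f := by
  induction j, hkj using Nat.le_induction with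
  | base => rfl
  | succ j hkj ih => rw [iterate_juxtStep_succ_eq hw j f (dyadicStep_mono hkj hf), ih]

theorem exists_tendsto_iterate_juxtStep [CompleteSpace V] {δ : ((Fin n → Bool) → V) →L[ℝ] V}
    (hδ : ∀ x, ‖δ x‖ ≤ ((2 : ℝ) ^ n)⁻¹ * ∑ σ, ‖x σ‖) {w : Lp B 1 (cubeMeasure n) →L[ℝ] V}
    (hw : ∀ f ∈ dyadicStep n B 0, juxtStep δ w f = w f) [CompleteSpace B] :
    ∃ θ : Lp B 1 (cubeMeasure n) →L[ℝ] V, ∀ f,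
      Filter.Tendsto (fun k => (juxtStep δ)^[k] w f) Filter.atTop (nhds (θ f)) := by
  have hlim (f : Lp B 1 (cubeMeasure n)) : ∃ y : V,
      Filter.Tendsto (fun k => (juxtStep δ)^[k] w f) Filter.atTop (nhds y) := by
    refine cauchySeq_tendsto_of_complete (Metric.cauchySeq_iff'.2 fun ε hε => ?_)
    have hC : 0 < 2 * (‖w‖ + 1) := by positivity
    obtain ⟨g, hg, hgD⟩ := Metric.dense_iff.1 (dense_iUnion_dyadicStep (n := n) (B := B)) f
      (ε / (2 * (‖w‖ + 1))) (by positivity)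
    obtain ⟨k, hk⟩ := Set.mem_iUnion.1 hgD
    rw [Metric.mem_ball, dist_comm, dist_eq_norm, lt_div_iff₀ hC] at hg
    have hb (j : ℕ) : ‖(juxtStep δ)^[j] w (f - g)‖ ≤ ‖w‖ * ‖f - g‖ :=
      ContinuousLinearMap.le_of_opNorm_le _ (norm_iterate_juxtStep_le hδ w j) _
    refine ⟨k, fun j hj => ?_⟩
    have heq : (juxtStep δ)^[j] w f - (juxtStep δ)^[k] w f =
        (juxtStep δ)^[j] w (f - g) - (juxtStep δ)^[k] w (f - g) := by
      rw [map_sub, map_sub, iterate_juxtStep_eq hw hj hk]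
      abel
    rw [dist_eq_norm, heq]
    have := norm_sub_le ((juxtStep δ)^[j] w (f - g)) ((juxtStep δ)^[k] w (f - g))
    linarith [hb j, hb k, norm_nonneg (f - g)]
  choose θ hθ using hlim
  exact ⟨continuousLinearMapOfTendsto (fun k => (juxtStep δ)^[k] w) (tendsto_pi_nhds.2 hθ), hθ⟩

/-- A continuous linear map intertwining juxtaposition with `δ` is determined by its values on
constant functions. -/
theorem eq_of_eq_on_const {δ : ((Fin n → Bool) → V) → V}
    {θ θ' : Lp B 1 (cubeMeasure n) →L[ℝ] V}
    (hθ : ∀ f, θ f = δ fun σ => θ (subcubeRestrict σ f))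
    (hθ' : ∀ f, θ' f = δ fun σ => θ' (subcubeRestrict σ f))
    (h : ∀ f ∈ dyadicStep n B 0, θ f = θ' f) : θ = θ' := by
  have hk (k : ℕ) : ∀ f ∈ dyadicStep n B k, θ f = θ' f := by
    induction k with
    | zero => exact h
    | succ k ih =>
      intro f hf
      rw [hθ, hθ']
      exact congrArg δ (funext fun σ => ih _ (hf σ))
  refine DFunLike.coe_injective (Continuous.ext_on dense_iUnion_dyadicStep θ.continuous
    θ'.continuous fun f hf => ?_)
  obtain ⟨k, hf⟩ := Set.mem_iUnion.1 hf
  exact hk k f hf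

end Iteration

/-- universal property of `L¹([0,1)^n; B)`: for a Banach space `V` with a
contractive right `B`-action, `v ∈ V`, and an ℝ-linear, right `B`-linear contraction-like
`δ : V^{2^n} → V` fixing `(v,…,v)`, there is a unique continuous ℝ-linear, right
`B`-linear map `θ : L¹([0,1)^n; B) → V` with `θ(const 1_B) = v` and `θ ∘ Γ = δ ∘ θ^{2^n}`. -/
theorem initial_object_property_L1_bimodule
    (n : ℕ) (hn : 1 ≤ n)
    (B : Type*) [NormedRing B] [NormedAlgebra ℝ B] [CompleteSpace B]
    (V : Type*) [NormedAddCommGroup V] [NormedSpace ℝ V] [CompleteSpace V]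
    -- the right B-module structure on V
    (act : V → B → V)
    (hact_add_left : ∀ (x y : V) (b : B), act (x + y) b = act x b + act y b)
    (hact_add_right : ∀ (x : V) (b₁ b₂ : B), act x (b₁ + b₂) = act x b₁ + act x b₂)
    (hact_one : ∀ x : V, act x 1 = x)
    (hact_mul : ∀ (x : V) (b₁ b₂ : B), act x (b₁ * b₂) = act (act x b₁) b₂)
    (hact_smul : ∀ (r : ℝ) (x : V) (b : B), act (r • x) b = r • act x b)
    (hact_norm : ∀ (x : V) (b : B), ‖act x b‖ ≤ ‖x‖ * ‖b‖)
    (v : V)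
    (δ : ((Fin n → Bool) → V) →ₗ[ℝ] V)
    (hδB : ∀ (x : (Fin n → Bool) → V) (b : B), δ (fun σ => act (x σ) b) = act (δ x) b)
    (hδv : δ (fun _ => v) = v)
    (hδnorm : ∀ x : (Fin n → Bool) → V, ‖δ x‖ ≤ ((2 : ℝ) ^ n)⁻¹ * ∑ σ, ‖x σ‖) :
    ∃! θ : Lp B 1 (cubeMeasure n) →L[ℝ] V,
      -- θ is right B-linear
      (∀ (f g : Lp B 1 (cubeMeasure n)) (b : B),
        ⇑g =ᵐ[cubeMeasure n] (fun x => f x * b) → θ g = act (θ f) b) ∧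
      -- θ sends the constant function with value 1_B to v
      (∀ one : Lp B 1 (cubeMeasure n),
        ⇑one =ᵐ[cubeMeasure n] (fun _ => (1 : B)) → θ one = v) ∧
      -- θ intertwines the juxtaposition with δ
      (∀ (F : (Fin n → Bool) → Lp B 1 (cubeMeasure n)) (h : Lp B 1 (cubeMeasure n)),
        ⇑h =ᵐ[cubeMeasure n] juxtFun (fun σ => ⇑(F σ)) →
          θ h = δ (fun σ => θ (F σ))) := by
  let δ' : ((Fin n → Bool) → V) →L[ℝ] V := δ.mkContinuous 1 fun x => by
    refine (hδnorm x).trans ((inv_mul_le_iff₀ (by positivity)).2 ?_)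
    refine (Finset.sum_le_sum fun σ _ => norm_le_pi_norm x σ).trans_eq ?_
    simp
  have hact_cont (b : B) : Continuous fun x => act x b :=
    AddMonoidHomClass.continuous_of_bound
      (AddMonoidHom.mk' (fun x => act x b) fun x y => hact_add_left x y b) ‖b‖ fun x =>
        (hact_norm x b).trans_eq (mul_comm _ _)
  let A : B →+ V := AddMonoidHom.mk' (act v) (hact_add_right v)
  let A' : B →L[ℝ] V := A.toRealLinearMap
    (AddMonoidHomClass.continuous_of_bound A ‖v‖ (hact_norm v))
  let w : Lp B 1 (cubeMeasure n) →L[ℝ] V := A'.comp (L1.integralCLM' ℝ)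
  have hwi (f : Lp B 1 (cubeMeasure n)) : w f = act v (∫ x, f x ∂cubeMeasure n) := by
    rw [← L1.integral_eq_integral, L1.integral_eq]
    rfl
  have hwc (f : Lp B 1 (cubeMeasure n)) (b : B) (hf : f =ᵐ[cubeMeasure n] fun _ => b) :
      w f = act v b := by
    rw [hwi, integral_congr_ae hf]
    simp
  have hw : ∀ f ∈ dyadicStep n B 0, juxtStep δ' w f = w f := by
    rintro f ⟨b, hb⟩
    have hσ (σ : Fin n → Bool) : w (subcubeRestrict σ f) = act v b :=
      hwc _ b (subcubeRestrict_ae_eq hb σ)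
    rw [juxtStep_apply, hwc f b hb]
    simp_rw [hσ]
    exact (hδB (fun _ => v) b).trans (by rw [hδv])
  obtain ⟨θ, hθ⟩ := exists_tendsto_iterate_juxtStep (δ := δ') hδnorm hw
  have hθc (f : Lp B 1 (cubeMeasure n)) (b : B) (hf : f =ᵐ[cubeMeasure n] fun _ => b) :
      θ f = act v b := by
    refine tendsto_nhds_unique (hθ f) (tendsto_const_nhds.congr fun k => ?_)
    rw [iterate_juxtStep_eq hw k.zero_le ⟨b, hf⟩]
    exact (hwc f b hf).symm
  have hθδ (f : Lp B 1 (cubeMeasure n)) : θ f = δ fun σ => θ (subcubeRestrict σ f) := by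
    refine tendsto_nhds_unique ((Filter.tendsto_add_atTop_iff_nat 1).2 (hθ f)) ?_
    simp_rw [Function.iterate_succ_apply', juxtStep_apply]
    exact (δ'.continuous.tendsto _).comp (tendsto_pi_nhds.2 fun σ => hθ (subcubeRestrict σ f))
  have hθB (f g : Lp B 1 (cubeMeasure n)) (b : B)
      (hg : g =ᵐ[cubeMeasure n] fun x => f x * b) : θ g = act (θ f) b := by
    refine tendsto_nhds_unique (hθ g) ((((hact_cont b).tendsto _).comp (hθ f)).congr fun k => ?_)
    symm
    induction k generalizing f g with
    | zero =>
      change w g = act (w f) b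
      rw [hwi, hwi, integral_congr_ae hg, integral_mul_const_of_integrable (L1.integrable_coeFn f),
        hact_mul]
    | succ k ih =>
      rw [Function.comp_apply, Function.iterate_succ_apply', juxtStep_apply, juxtStep_apply]
      refine Eq.trans (congrArg δ' (funext fun σ => ?_)) (hδB _ b)
      refine ih _ _ ((subcubeRestrict_ae_eq hg σ).trans ?_)
      filter_upwards [coeFn_subcubeRestrict σ f] with x hx
      rw [hx]
  refine ⟨θ, ⟨hθB, fun one hone => (hθc one 1 hone).trans (hact_one v), fun F h hF => ?_⟩, ?_⟩
  · rw [hθδ]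
    simp_rw [ae_eq_juxtFun_iff.1 hF]
  · rintro θ' ⟨hB, h1, hΓ⟩
    refine eq_of_eq_on_const (δ := δ)
      (fun f => hΓ _ f (ae_eq_juxtFun_iff.2 fun σ => rfl)) hθδ ?_
    rintro f ⟨b, hb⟩
    have hi : Integrable (fun _ => (1 : B)) (cubeMeasure n) := integrable_const _
    rw [hθc f b hb, ← h1 _ hi.coeFn_toL1]
    refine hB _ f b ?_
    filter_upwards [hb, hi.coeFn_toL1] with x hx h1x
    rw [hx, h1x, one_mul]
end
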